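/- Let d ≥ 3 and m ≥ 4, and for each t ≥ 3 let H_t be the graph on t + d vertices consisting of a t-cycle together with d further vertices each adjacent to all other vertices. Then τ₀(H_m) − τ₀(H_{m−1}) = 1/((d+3)(d+2)) − 1/((m+d+1)(m+d)) − 1/((m+d+1)·C(m+d, d+1)). -/

import Mathlib

open Finset

/-- `τ₀` of a finite simple graph. -/
noncomputable def tau0 {V : Type*} [Fintype V] (G : SimpleGraph V) : ℚ :=
  ((Fintype.card V : ℚ) + 1)⁻¹ *
    ∑ W : Finset V,
      (if W.Nonempty then (Nat.card (G.induce (↑W : Set V)).ConnectedComponent : ℚ) - 1 else 0) /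
        ((Fintype.card V).choose W.card : ℚ)

/-- The graph `H_t` on `t + d` vertices consisting of a `t`-cycle on the first `t` vertices
together with `d` further vertices each adjacent to all other vertices. -/
def cycleJoinGraph (t d : ℕ) : SimpleGraph (Fin (t + d)) :=
  SimpleGraph.fromRel (fun u v =>
    ((u : ℕ) < t ∧ (v : ℕ) < t ∧ ((u : ℕ) + 1) % t = (v : ℕ)) ∨ t ≤ (u : ℕ))

/-- The value `∫₀¹ xᵏ (1 - x)ⁿ⁻ᵏ dx = 1 / ((n + 1) * C(n, k))` of the beta integral. -/
def betaWeight (n k : ℕ) : ℚ := (((n : ℚ) + 1) * (n.choose k : ℚ))⁻¹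

theorem betaWeight_add_succ {n k : ℕ} (h : k ≤ n) :
    betaWeight (n + 1) k + betaWeight (n + 1) (k + 1) = betaWeight n k := by
  have h1 := Nat.add_one_mul_choose_eq n k
  have h2 := Nat.choose_mul_succ_eq n k
  have c0 : (n.choose k : ℚ) ≠ 0 := by exact_mod_cast (Nat.choose_pos h).ne'
  obtain ⟨j, rfl⟩ := Nat.exists_eq_add_of_le h
  rw [show k + j + 1 - k = j + 1 by omega] at h2
  have h1' : ((k + j : ℚ) + 1) * ((k + j).choose k : ℚ)
      = ((k + j + 1).choose (k + 1) : ℚ) * (k + 1) := by exact_mod_cast h1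
  have h2' : ((k + j).choose k : ℚ) * (k + j + 1)
      = ((k + j + 1).choose k : ℚ) * (j + 1) := by exact_mod_cast h2
  have e1 : ((k + j + 1).choose (k + 1) : ℚ)
      = ((k + j : ℚ) + 1) * ((k + j).choose k : ℚ) / (k + 1) := by
    rw [h1']; field_simp
  have e2 : ((k + j + 1).choose k : ℚ)
      = ((k + j).choose k : ℚ) * (k + j + 1) / (j + 1) := by
    rw [h2']; field_simp
  unfold betaWeight
  rw [e1, e2]
  push_cast
  field_simp
  ring

theorem sum_powerset_betaWeight {α : Type*} [DecidableEq α] (D : Finset α) {n k : ℕ}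
    (h : k ≤ n) :
    ∑ S ∈ D.powerset, betaWeight (n + #D) (k + #S) = betaWeight n k := by
  induction D using Finset.induction_on with
  | empty => simp
  | insert a D ha ih =>
    rw [sum_powerset_insert ha, ← sum_add_distrib, ← ih]
    refine sum_congr rfl fun S hS => ?_
    rw [mem_powerset] at hS
    rw [card_insert_of_notMem ha, card_insert_of_notMem fun h' => ha (hS h'), ← add_assoc,
      ← add_assoc]
    exact betaWeight_add_succ (add_le_add h (card_le_card hS))

theorem SimpleGraph.card_connectedComponent_eq_of_retraction {α : Type*} (G : SimpleGraph α)
    (P : α → Prop) (e : α → α) (hP : ∀ a, P (e a)) (he : ∀ a, P a → e a = a)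
    (hr : ∀ a, G.Reachable a (e a)) (hadj : ∀ a b, G.Adj a b → e a = e b) :
    Nat.card G.ConnectedComponent = Nat.card {a // P a} := by
  have hreach : ∀ a b, G.Reachable a b → e a = e b := by
    rintro a b ⟨p⟩
    induction p with
    | nil => rfl
    | cons h _ ih => exact (hadj _ _ h).trans ih
  symm
  refine Nat.card_congr (Equiv.ofBijective (fun a => G.connectedComponentMk a.1) ⟨?_, ?_⟩)
  · rintro ⟨a, ha⟩ ⟨b, hb⟩ h
    have := hreach a b (SimpleGraph.ConnectedComponent.exact h)
    rw [he a ha, he b hb] at this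
    exact Subtype.ext this
  · intro c
    induction c using SimpleGraph.ConnectedComponent.ind with
    | _ v => exact ⟨⟨e v, hP v⟩, (SimpleGraph.ConnectedComponent.sound (hr v)).symm⟩

theorem SimpleGraph.card_connectedComponent_induce_of_successor {V : Type*} [DecidableEq V]
    (G : SimpleGraph V) (s : V → V) (W : Finset V)
    (hG : ∀ u ∈ W, ∀ v ∈ W, G.Adj u v ↔ u ≠ v ∧ (s u = v ∨ s v = u))
    (hW : ∀ v ∈ W, ∃ k, s^[k + 1] v ∉ W) :
    Nat.card (G.induce (W : Set V)).ConnectedComponent = #{v ∈ W | s v ∉ W} := by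
  have key : ∀ k, ∀ v (hv : v ∈ W), s^[k + 1] v ∉ W → ∃ w, ∃ hw : w ∈ W, s w ∉ W ∧
      (G.induce (W : Set V)).Reachable ⟨v, hv⟩ ⟨w, hw⟩ ∧ ∃ j, w = s^[j] v ∧
        ∀ i ≤ j, s^[i] v ∈ W := by
    intro k
    induction k with
    | zero => exact fun v hv h => ⟨v, hv, h, .rfl, 0, rfl, by simpa using hv⟩
    | succ k ih =>
      intro v hv h
      by_cases hs : s v ∈ W
      · obtain ⟨w, hw, h1, h2, j, rfl, h3⟩ := ih (s v) hs h
        refine ⟨_, hw, h1, ?_, j + 1, rfl, ?_⟩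
        · by_cases hvs : v = s v
          · convert h2
          · refine SimpleGraph.Reachable.trans (SimpleGraph.Adj.reachable ?_) h2
            exact (hG v hv _ hs).2 ⟨hvs, .inl rfl⟩
        · rintro (_ | i) hi
          · exact hv
          · exact h3 i (by omega)
      · exact ⟨v, hv, hs, .rfl, 0, rfl, by simpa using hv⟩
  have huniq : ∀ v i j, s (s^[i] v) ∉ W → s (s^[j] v) ∉ W → (∀ l ≤ i, s^[l] v ∈ W) →
      (∀ l ≤ j, s^[l] v ∈ W) → i = j := by
    intro v i j hi hj hi' hj'
    rw [← Function.iterate_succ_apply' s] at hi hj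
    by_contra hne
    rcases Nat.lt_or_gt_of_ne hne with h | h
    · exact hi (hj' _ h)
    · exact hj (hi' _ h)
  choose! e he using fun v (hv : v ∈ W) => (hW v hv).elim fun k hk => key k v hv hk
  have hfix : ∀ v ∈ W, s v ∉ W → e v = v := by
    intro v hv hs
    obtain ⟨hw, h1, -, j, h2, h3⟩ := he v hv
    rw [h2] at h1
    rw [h2, huniq v j 0 h1 hs h3 (by simpa using hv)]
    rfl
  have hstep : ∀ v ∈ W, s v ∈ W → e v = e (s v) := by
    intro v hv hs
    obtain ⟨-, h1, -, j, h2, h3⟩ := he v hv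
    obtain ⟨-, h1', -, j', h2', h3'⟩ := he (s v) hs
    rw [h2] at h1
    rw [h2'] at h1'
    rw [h2, h2', huniq v j (j' + 1) h1 h1' h3, Function.iterate_succ_apply]
    rintro (_ | i) hi
    · exact hv
    · exact h3' i (by omega)
  rw [SimpleGraph.card_connectedComponent_eq_of_retraction _ (fun a => s a.1 ∉ W)
    (fun a => ⟨e a.1, (he a.1 a.2).1⟩) (fun a => (he a.1 a.2).2.1)
    (fun a ha => Subtype.ext (hfix a.1 a.2 ha)) (fun a => (he a.1 a.2).2.2.1)]
  · rw [← Nat.card_eq_finsetCard]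
    exact Nat.card_congr
      ((Equiv.subtypeSubtypeEquivSubtypeInter (· ∈ W) (fun a => s a ∉ W)).trans
        (Equiv.subtypeEquivRight fun a => by simp))
  · rintro ⟨a, ha⟩ ⟨b, hb⟩ hab
    refine Subtype.ext ?_
    obtain ⟨-, rfl | rfl⟩ := (hG a ha b hb).1 hab
    · exact hstep a ha hb
    · exact (hstep b hb ha).symm

/-- The cyclic successor on the first `t` vertices of `Fin (t + d)`. -/
def cycleSucc (t d : ℕ) [NeZero t] (u : Fin (t + d)) : Fin (t + d) :=
  ⟨((u : ℕ) + 1) % t, (Nat.mod_lt _ (NeZero.pos t)).trans_le (Nat.le_add_right t d)⟩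

/-- The vertices of the cycle in `cycleJoinGraph t d`. -/
def cyclePart (t d : ℕ) : Finset (Fin (t + d)) := {u | (u : ℕ) < t}

theorem mem_cyclePart {t d : ℕ} {u : Fin (t + d)} : u ∈ cyclePart t d ↔ (u : ℕ) < t := by
  simp [cyclePart]

theorem card_cyclePart (t d : ℕ) : #(cyclePart t d) = t := by
  simp [cyclePart, Fin.card_filter_val_lt]

theorem cycleSucc_mem (t d : ℕ) [NeZero t] (u : Fin (t + d)) :
    cycleSucc t d u ∈ cyclePart t d :=
  mem_cyclePart.2 (Nat.mod_lt _ (NeZero.pos t))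

theorem cycleSucc_ne {t d : ℕ} [NeZero t] (ht : 2 ≤ t) {u : Fin (t + d)}
    (hu : u ∈ cyclePart t d) : cycleSucc t d u ≠ u := by
  intro h
  have h' : ((u : ℕ) + 1) % t = u := congrArg Fin.val h
  rw [mem_cyclePart] at hu
  rcases (Nat.succ_le_of_lt hu).lt_or_eq with h1 | h1
  · rw [Nat.mod_eq_of_lt h1] at h'; omega
  · rw [show (u : ℕ) + 1 = t from h1, Nat.mod_self] at h'; omega

theorem cycleSucc_iterate {t d : ℕ} [NeZero t] {u : Fin (t + d)} (hu : u ∈ cyclePart t d)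
    (k : ℕ) : (((cycleSucc t d)^[k] u : Fin (t + d)) : ℕ) = (u + k) % t := by
  induction k with
  | zero => exact (Nat.mod_eq_of_lt (mem_cyclePart.1 hu)).symm
  | succ k ih =>
    rw [Function.iterate_succ_apply']
    simp only [cycleSucc, ih]
    rw [Nat.mod_add_mod, add_assoc]

theorem cycleJoinGraph_adj_of_mem {t d : ℕ} [NeZero t] {u v : Fin (t + d)}
    (hu : u ∈ cyclePart t d) (hv : v ∈ cyclePart t d) :
    (cycleJoinGraph t d).Adj u v ↔ u ≠ v ∧ (cycleSucc t d u = v ∨ cycleSucc t d v = u) := by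
  rw [mem_cyclePart] at hu hv
  simp [cycleJoinGraph, cycleSucc, Fin.ext_iff, hu, hv, not_le.2 hu, not_le.2 hv]

theorem card_connectedComponent_cycleJoinGraph_of_ssubset {t d : ℕ} [NeZero t]
    {W : Finset (Fin (t + d))} (hW : W ⊂ cyclePart t d) :
    Nat.card ((cycleJoinGraph t d).induce (W : Set (Fin (t + d)))).ConnectedComponent
      = #{v ∈ W | cycleSucc t d v ∉ W} := by
  refine SimpleGraph.card_connectedComponent_induce_of_successor _ _ _
    (fun u hu v hv => cycleJoinGraph_adj_of_mem (hW.1 hu) (hW.1 hv)) fun v hv => ?_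
  obtain ⟨w, hw, hwW⟩ := exists_of_ssubset hW
  have hv' := mem_cyclePart.1 (hW.1 hv)
  have hw' := mem_cyclePart.1 hw
  refine ⟨w + t - v - 1, ?_⟩
  convert hwW
  rw [Fin.ext_iff, cycleSucc_iterate (hW.1 hv),
    show (v : ℕ) + (w + t - v - 1 + 1) = w + t by omega, Nat.add_mod_right,
    Nat.mod_eq_of_lt hw']

theorem card_connectedComponent_cycleJoinGraph_cyclePart (t d : ℕ) [NeZero t] :
    Nat.card ((cycleJoinGraph t d).induce
      (cyclePart t d : Set (Fin (t + d)))).ConnectedComponent = 1 := by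
  have h0 : (⟨0, Nat.add_pos_left (NeZero.pos t) d⟩ : Fin (t + d)) ∈ cyclePart t d :=
    mem_cyclePart.2 (NeZero.pos t)
  have hr : ∀ i (hi : i < t), ((cycleJoinGraph t d).induce
      (cyclePart t d : Set (Fin (t + d)))).Reachable
        ⟨⟨i, Nat.lt_add_right d hi⟩, mem_cyclePart.2 hi⟩ ⟨_, h0⟩ := by
    intro i
    induction i with
    | zero => exact fun _ => .rfl
    | succ i ih =>
      intro hi
      refine SimpleGraph.Reachable.trans (SimpleGraph.Adj.reachable ?_) (ih (by omega))
      refine (cycleJoinGraph_adj_of_mem (mem_cyclePart.2 hi)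
        (mem_cyclePart.2 (Nat.lt_of_succ_lt hi))).2 ⟨by simp, .inr ?_⟩
      simp [cycleSucc, Nat.mod_eq_of_lt hi]
  rw [SimpleGraph.card_connectedComponent_eq_of_retraction _ (fun a => a = ⟨_, h0⟩)
    (fun _ => ⟨_, h0⟩) (fun _ => rfl) (fun _ h => h.symm)
    (fun a => hr a.1 (mem_cyclePart.1 a.2)) fun _ _ _ => rfl]
  simp

theorem card_connectedComponent_cycleJoinGraph_of_not_subset {t d : ℕ}
    {W : Finset (Fin (t + d))} (hW : ¬ W ⊆ cyclePart t d) :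
    Nat.card ((cycleJoinGraph t d).induce (W : Set (Fin (t + d)))).ConnectedComponent = 1 := by
  obtain ⟨w, hw, hwC⟩ := not_subset.1 hW
  rw [mem_cyclePart, not_lt] at hwC
  rw [SimpleGraph.card_connectedComponent_eq_of_retraction _ (fun a => a = ⟨w, hw⟩)
    (fun _ => ⟨w, hw⟩) (fun _ => rfl) (fun _ h => h.symm) (fun a => ?_) fun _ _ _ => rfl]
  · simp
  · by_cases ha : a = ⟨w, hw⟩
    · rw [ha]
    · refine SimpleGraph.Adj.reachable ?_
      have ha' : a.1 ≠ w := fun h => ha (Subtype.ext h)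
      simp [cycleJoinGraph, hwC, ha']

theorem sum_powerset_betaWeight_arcs {t d : ℕ} [NeZero t] (ht : 2 ≤ t) :
    ∑ W ∈ (cyclePart t d).powerset,
      (#{v ∈ W | cycleSucc t d v ∉ W} : ℚ) * betaWeight (t + d) #W
        = t * betaWeight (d + 2) 1 := by
  have hone : ∀ v ∈ cyclePart t d, ∑ W ∈ (cyclePart t d).powerset,
      (if v ∈ W ∧ cycleSucc t d v ∉ W then betaWeight (t + d) #W else 0)
        = betaWeight (d + 2) 1 := by
    intro v hv
    have hne := cycleSucc_ne ht hv
    have hs := cycleSucc_mem t d v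
    generalize cycleSucc t d v = w at hne hs
    obtain ⟨D, hwD, hD⟩ : ∃ D, v ∉ D ∧ cyclePart t d = insert v D :=
      ⟨_, notMem_erase v _, (insert_erase hv).symm⟩
    have hw : w ∈ D := by
      rw [hD] at hs
      exact (mem_insert.1 hs).resolve_left hne
    obtain ⟨E, hwE, rfl⟩ : ∃ E, w ∉ E ∧ D = insert w E :=
      ⟨_, notMem_erase w _, (insert_erase hw).symm⟩
    have hcard : #E + 2 = t := by
      have := card_cyclePart t d
      rwa [hD, card_insert_of_notMem hwD, card_insert_of_notMem hwE] at this
    have hvE : v ∉ E := fun h => hwD (mem_insert_of_mem h)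
    rw [hD, sum_powerset_insert hwD, sum_powerset_insert hwE, sum_powerset_insert hwE,
      ← sum_powerset_betaWeight E (show 1 ≤ d + 2 by omega)]
    have h1 : ∀ S ∈ E.powerset,
        (if v ∈ S ∧ w ∉ S then betaWeight (t + d) #S else 0) = 0 := fun S hS =>
      if_neg fun h => hvE (mem_powerset.1 hS h.1)
    rw [sum_eq_zero h1, sum_eq_zero (fun S _ => if_neg (by simp)),
      sum_eq_zero (s := E.powerset) (f := fun S => if v ∈ insert v (insert w S) ∧ _ then _ else _)
        (fun S _ => if_neg (by simp)), zero_add, zero_add, add_zero]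
    refine sum_congr rfl fun S hS => ?_
    have hvS : v ∉ S := fun h => hvE (mem_powerset.1 hS h)
    have hwS : w ∉ S := fun h => hwE (mem_powerset.1 hS h)
    rw [if_pos ⟨mem_insert_self _ _, by simp [hne, hwS]⟩, card_insert_of_notMem hvS]
    congr 1 <;> omega
  calc _ = ∑ W ∈ (cyclePart t d).powerset, ∑ v ∈ cyclePart t d,
        (if v ∈ W ∧ cycleSucc t d v ∉ W then betaWeight (t + d) #W else 0) := by
        refine sum_congr rfl fun W hW => ?_
        rw [← sum_filter, sum_const, nsmul_eq_mul]
        congr 3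
        ext v
        simp only [mem_filter]
        exact ⟨fun h => ⟨mem_powerset.1 hW h.1, h⟩, fun h => h.2⟩
    _ = _ := by
        rw [sum_comm, sum_congr rfl hone, sum_const, card_cyclePart, nsmul_eq_mul]

theorem tau0_cycleJoinGraph {t : ℕ} (d : ℕ) (ht : 2 ≤ t) :
    tau0 (cycleJoinGraph t d) = t * betaWeight (d + 2) 1 - betaWeight d 0
      + betaWeight (t + d) 0 + betaWeight (t + d) t := by
  have : NeZero t := ⟨by omega⟩
  have hC : (cyclePart t d).Nonempty := card_pos.1 (by rw [card_cyclePart]; omega)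
  have hterm : ∀ W ∈ (cyclePart t d).powerset,
      (((t + d : ℕ) : ℚ) + 1)⁻¹ * ((if W.Nonempty then
        (Nat.card ((cycleJoinGraph t d).induce
          (W : Set (Fin (t + d)))).ConnectedComponent : ℚ) - 1 else 0) /
            ((t + d).choose #W : ℚ))
      = (#{v ∈ W | cycleSucc t d v ∉ W} : ℚ) * betaWeight (t + d) #W - betaWeight (t + d) #W
        + (if W = ∅ then betaWeight (t + d) #W else 0)
        + (if W = cyclePart t d then betaWeight (t + d) #W else 0) := by
    intro W hW
    rw [mem_powerset] at hW
    rcases W.eq_empty_or_nonempty with rfl | hne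
    · simp [hC.ne_empty.symm]
    rw [if_pos hne, if_neg hne.ne_empty]
    rcases hW.eq_or_ssubset with rfl | hss
    · rw [card_connectedComponent_cycleJoinGraph_cyclePart, if_pos rfl]
      simp [cycleSucc_mem]
    · rw [card_connectedComponent_cycleJoinGraph_of_ssubset hss, if_neg hss.ne, betaWeight,
        mul_inv]
      ring
  have hpow := sum_powerset_betaWeight (cyclePart t d) (Nat.zero_le d)
  simp only [card_cyclePart, zero_add, add_comm d t] at hpow
  rw [tau0, Fintype.card_fin, ← sum_subset (subset_univ (cyclePart t d).powerset), mul_sum,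
    sum_congr rfl hterm, sum_add_distrib, sum_add_distrib, sum_sub_distrib,
    sum_powerset_betaWeight_arcs ht, hpow, sum_ite_eq', sum_ite_eq',
    if_pos (empty_mem_powerset _), if_pos (mem_powerset_self _), card_empty, card_cyclePart]
  intro W _ hW
  rw [mem_powerset] at hW
  rw [card_connectedComponent_cycleJoinGraph_of_not_subset hW]
  simp

/-- for `d ≥ 3` and `m ≥ 4`,
`τ₀(H_m) − τ₀(H_{m−1}) = 1/((d+3)(d+2)) − 1/((m+d+1)(m+d)) − 1/((m+d+1)·C(m+d, d+1))`. -/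
theorem tau0_cycle_join_diff (d m : ℕ) (hd : 3 ≤ d) (hm : 4 ≤ m) :
    tau0 (cycleJoinGraph m d) - tau0 (cycleJoinGraph (m - 1) d)
      = 1 / (((d : ℚ) + 3) * ((d : ℚ) + 2))
        - 1 / (((m : ℚ) + (d : ℚ) + 1) * ((m : ℚ) + (d : ℚ)))
        - 1 / (((m : ℚ) + (d : ℚ) + 1) * ((m + d).choose (d + 1) : ℚ)) := by
  obtain ⟨t, rfl⟩ : ∃ t, m = t + 1 := ⟨m - 1, by omega⟩
  have hrec := betaWeight_add_succ (n := t + d) (k := t) (by omega)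
  have hsymm : (t + 1 + d).choose (d + 1) = (t + 1 + d).choose t := by
    rw [← Nat.choose_symm_of_eq_add (show t + 1 + d = t + (d + 1) by omega)]
  have hw : 1 / ((((t + 1 : ℕ) : ℚ) + (d : ℚ) + 1) * ((t + 1 + d).choose (d + 1) : ℚ))
      = betaWeight (t + d + 1) t := by
    rw [hsymm, show t + 1 + d = t + d + 1 by omega, betaWeight, one_div]
    push_cast
    ring_nf
  rw [Nat.add_sub_cancel, tau0_cycleJoinGraph d (by omega), tau0_cycleJoinGraph d (by omega), hw,
    show t + 1 + d = t + d + 1 by omega, ← hrec]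
  simp only [betaWeight, Nat.choose_zero_right, Nat.choose_one_right]
  push_cast
  have e1 : 1 / (((d : ℚ) + 3) * (d + 2)) = ((d + 2 + 1) * (d + 2) : ℚ)⁻¹ := by
    rw [one_div]; ring_nf
  have e2 : 1 / (((t : ℚ) + 1 + d + 1) * (t + 1 + d))
      = ((t + d + 1) * 1 : ℚ)⁻¹ - ((t + d + 1 + 1) * 1 : ℚ)⁻¹ := by
    field_simp
    ring
  rw [e1, e2]
  ring
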